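/- Let m < n be positive integers, let E ⊂ ℝⁿ with H^m(E) < ∞, let P : ℝⁿ → ℝ^m be Lipschitz continuous, and let δ > 0. Define E₂ := {a ∈ E : limsup_{s→0} sup_{0<r<δ} (rs)^{−m} H^m(E ∩ X(a,r,s)) = ∞}. Then H^m(P(E₂)) = 0. -/

import Mathlib

open MeasureTheory Set Metric Filter ENNReal

/-- The truncated cone `X(a,r,s) = {x : |P x - P a| < s |x - a|} ∩ B(a,r)` around the preimage
`P⁻¹(P a)`. -/
def coneX {n m : ℕ} (P : EuclideanSpace ℝ (Fin n) → EuclideanSpace ℝ (Fin m))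
    (a : EuclideanSpace ℝ (Fin n)) (r s : ℝ) : Set (EuclideanSpace ℝ (Fin n)) :=
  {x | ‖P x - P a‖ < s * ‖x - a‖} ∩ Metric.closedBall a r

/-- `limsup_{s → 0+} sup_{0 < r < δ} (r s)^{-m} H^m (A ∩ X(a,r,s))`. -/
noncomputable def coneDensity {n m' : ℕ} (m : ℕ)
    (P : EuclideanSpace ℝ (Fin n) → EuclideanSpace ℝ (Fin m'))
    (A : Set (EuclideanSpace ℝ (Fin n))) (a : EuclideanSpace ℝ (Fin n)) (δ : ℝ) : ℝ≥0∞ :=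
  Filter.limsup
    (fun s : ℝ => ⨆ r ∈ Set.Ioo (0 : ℝ) δ,
      (ENNReal.ofReal ((r * s) ^ m))⁻¹ * μH[m] (A ∩ coneX P a r s))
    (nhdsWithin 0 (Set.Ioi 0))

/-- At a point around whose image the pushforward of `H^m` restricted to `E` has bounded ball ratios
with respect to `H^m` at small scales, the cone density is finite. -/
lemma coneDensity_lt_top_of_eventually_div_lt {n m : ℕ}
    (P : EuclideanSpace ℝ (Fin n) → EuclideanSpace ℝ (Fin m)) (hP : Measurable P)
    (E : Set (EuclideanSpace ℝ (Fin n))) (a : EuclideanSpace ℝ (Fin n)) {δ : ℝ} (hδ : 0 < δ)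
    [(μH[m] : Measure (EuclideanSpace ℝ (Fin m))).IsAddHaarMeasure] {C : ℝ≥0∞} (hC : C ≠ ⊤)
    (h : ∀ᶠ t in nhdsWithin (0 : ℝ) (Set.Ioi 0),
      Measure.map P (μH[m].restrict E) (closedBall (P a) t) / μH[m] (closedBall (P a) t) < C) :
    coneDensity m P E a δ < ⊤ := by
  set c : ℝ≥0∞ := μH[m] (ball (0 : EuclideanSpace ℝ (Fin m)) 1)
  have hc_top : c ≠ ⊤ := measure_ball_lt_top.ne
  refine lt_of_le_of_lt ?_ (ENNReal.mul_lt_top hC.lt_top hc_top.lt_top)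
  obtain ⟨ε, hε, hball⟩ := (mem_nhdsGT_iff_exists_Ioo_subset).1 h
  refine limsup_le_of_le (by isBoundedDefault) ?_
  filter_upwards [Ioo_mem_nhdsGT (div_pos hε hδ)] with s hs
  refine iSup₂_le fun r hr => ?_
  have hrs : 0 < r * s := mul_pos hr.1 hs.1
  have hrsε : r * s < ε := by
    have := (lt_div_iff₀ hδ).1 hs.2
    nlinarith [hr.2, hs.1]
  have hratio : Measure.map P (μH[m].restrict E) (closedBall (P a) (r * s)) /
      μH[m] (closedBall (P a) (r * s)) < C := hball ⟨hrs, hrsε⟩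
  have hvol : μH[m] (closedBall (P a) (r * s)) = ENNReal.ofReal ((r * s) ^ m) * c := by
    rw [Measure.addHaar_closedBall _ _ hrs.le, finrank_euclideanSpace_fin]
  have hpos : μH[m] (closedBall (P a) (r * s)) ≠ 0 := (measure_closedBall_pos _ _ hrs).ne'
  have hfin : μH[m] (closedBall (P a) (r * s)) ≠ ⊤ := measure_closedBall_lt_top.ne
  have hcone : μH[m] (E ∩ coneX P a r s) ≤
      Measure.map P (μH[m].restrict E) (closedBall (P a) (r * s)) := by
    rw [Measure.map_apply hP measurableSet_closedBall,
      Measure.restrict_apply (hP measurableSet_closedBall), inter_comm]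
    refine measure_mono (inter_subset_inter_left _ ?_)
    rintro x ⟨hx, hxr⟩
    rw [mem_closedBall, dist_eq_norm] at hxr
    rw [mem_preimage, mem_closedBall, dist_eq_norm]
    exact hx.le.trans (by nlinarith [hs.1])
  have hbound : μH[m] (E ∩ coneX P a r s) ≤ C * (ENNReal.ofReal ((r * s) ^ m) * c) :=
    hcone.trans <| hvol ▸ (ENNReal.div_le_iff hpos hfin).1 hratio.le
  calc (ENNReal.ofReal ((r * s) ^ m))⁻¹ * μH[m] (E ∩ coneX P a r s)
      ≤ (ENNReal.ofReal ((r * s) ^ m))⁻¹ * (C * (ENNReal.ofReal ((r * s) ^ m) * c)) := by gcongr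
    _ = ((ENNReal.ofReal ((r * s) ^ m))⁻¹ * ENNReal.ofReal ((r * s) ^ m)) * (C * c) := by ring
    _ = C * c := by
      rw [ENNReal.inv_mul_cancel (by simpa using pow_pos hrs m) ENNReal.ofReal_ne_top, one_mul]

/-- If `E ⊆ ℝⁿ` has `H^m(E) < ∞` and `P : ℝⁿ → ℝ^m` is Lipschitz, then the image under `P` of
the set of points `a ∈ E` where the upper cone density
`limsup_{s→0} sup_{0<r<δ} (rs)^{-m} H^m(E ∩ X(a,r,s))` is infinite is `H^m`-null. -/
theorem image_null_of_cone_density_infinite {m n : ℕ} (hm : 0 < m) (hmn : m < n)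
    (E : Set (EuclideanSpace ℝ (Fin n))) (hEfin : μH[m] E < ⊤)
    (P : EuclideanSpace ℝ (Fin n) → EuclideanSpace ℝ (Fin m))
    (hP : ∃ K : NNReal, LipschitzWith K P) (δ : ℝ) (hδ : 0 < δ) :
    μH[m] (P '' {a ∈ E | coneDensity m P E a δ = ⊤}) = 0 := by
  obtain ⟨K, hK⟩ := hP
  have hPm : Measurable P := hK.continuous.measurable
  have : (μH[m] : Measure (EuclideanSpace ℝ (Fin m))).IsAddHaarMeasure := by
    have := isAddHaarMeasure_hausdorffMeasure (E := EuclideanSpace ℝ (Fin m))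
    rwa [finrank_euclideanSpace_fin] at this
  have : IsFiniteMeasure ((μH[m] : Measure (EuclideanSpace ℝ (Fin n))).restrict E) :=
    ⟨by simpa using hEfin⟩
  set ν := Measure.map P ((μH[m] : Measure (EuclideanSpace ℝ (Fin n))).restrict E)
  have hae : ∀ᵐ y ∂(μH[m] : Measure (EuclideanSpace ℝ (Fin m))),
      y ∉ P '' {a ∈ E | coneDensity m P E a δ = ⊤} := by
    filter_upwards [Besicovitch.ae_tendsto_rnDeriv ν μH[m], ν.rnDeriv_lt_top μH[m]]
      with y hlim hy
    rintro ⟨a, ⟨-, ha⟩, rfl⟩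
    obtain ⟨C, hC, hC_top⟩ := exists_between hy
    exact (coneDensity_lt_top_of_eventually_div_lt P hPm E a hδ hC_top.ne
      (hlim.eventually_lt_const hC)).ne ha
  exact measure_eq_zero_iff_ae_notMem.2 hae
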